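/- arXiv:1608.01827 — 2 statements merged into one kernel-verified Lean document; each statement's English description precedes it below -/
import Mathlib

section
/- If Q_{k+2} ≥ 0 (the VO at position k+2 is of type 1), then W̃_0 ≥ W_0: exchanging the bargaining positions k+1 and k+2, so that the type-1 VO bargains earlier, does not decrease the MNO's payoff. -/
open Finset

/-- Total offloading benefit `Σ_{t<T} f_t(Σ_{n<N} b_n X_n^t)` (0-based indices). -/
noncomputable def socialOffload (T N : ℕ) (f : ℕ → ℝ → ℝ) (X : ℕ → ℕ → ℝ)
    (b : ℕ → Bool) : ℝ :=
  ∑ t ∈ range T, f t (∑ n ∈ range N, if b n then X n t else 0)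

/-- `Waux T N f X Q j b = W_{N-j}(b)`: backward recursion on the number `j` of
remaining bargaining steps.  At step `k = N - (j+1)` (0-based) the recursion is
`W_k(b) = ½·W_{k+1}(b,0) + ½·max{W_{k+1}(b,0), W_{k+1}(b,1) + Q_k}`. -/
noncomputable def Waux (T N : ℕ) (f : ℕ → ℝ → ℝ) (X : ℕ → ℕ → ℝ) (Q : ℕ → ℝ) :
    ℕ → (ℕ → Bool) → ℝ
  | 0, b => socialOffload T N f X b
  | j + 1, b =>
      (1 / 2) * Waux T N f X Q j (Function.update b (N - (j + 1)) false)
        + (1 / 2) *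
          max (Waux T N f X Q j (Function.update b (N - (j + 1)) false))
            (Waux T N f X Q j (Function.update b (N - (j + 1)) true) + Q (N - (j + 1)))

/-- The value function `W_k(b)` of the sequential one-to-many Nash bargaining
(0-based: VO `n` has parameters `Q n`, `X n ·`; `b` is the prefix of outcomes,
only its entries `0,…,k-1` matter). -/
noncomputable def W (T N : ℕ) (f : ℕ → ℝ → ℝ) (X : ℕ → ℕ → ℝ) (Q : ℕ → ℝ)
    (k : ℕ) (b : ℕ → Bool) : ℝ :=
  Waux T N f X Q (N - k) b

/-- Parameters obtained by interchanging the VOs at (0-based) positions `k` and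
`k+1` (paper positions `k+1` and `k+2`). -/
def swapQ (Q : ℕ → ℝ) (k : ℕ) : ℕ → ℝ :=
  fun n => if n = k then Q (k + 1) else if n = k + 1 then Q k else Q n

def swapX (X : ℕ → ℕ → ℝ) (k : ℕ) : ℕ → ℕ → ℝ :=
  fun n t => if n = k then X (k + 1) t else if n = k + 1 then X k t else X n t

lemma swapQ_of_ne {Q : ℕ → ℝ} {k n : ℕ} (h₁ : n ≠ k) (h₂ : n ≠ k + 1) :
    swapQ Q k n = Q n := by
  simp [swapQ, h₁, h₂]

lemma swapX_eq_comp_swap (X : ℕ → ℕ → ℝ) (k : ℕ) :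
    swapX X k = X ∘ Equiv.swap k (k + 1) := by
  funext n t
  simp only [swapX, Function.comp_apply, Equiv.swap_apply_def]
  split_ifs <;> rfl

lemma update_comp_swap_of_ne (b : ℕ → Bool) (v : Bool) {i j n : ℕ} (h₁ : n ≠ i) (h₂ : n ≠ j) :
    Function.update b n v ∘ Equiv.swap i j = Function.update (b ∘ Equiv.swap i j) n v := by
  rw [Function.update_comp_equiv, Equiv.symm_swap, Equiv.swap_apply_of_ne_of_ne h₁ h₂]

/-- Interchanging the parameters of two operators relabels the outcomes. -/
lemma socialOffload_swapX (T N : ℕ) (f : ℕ → ℝ → ℝ) (X : ℕ → ℕ → ℝ) {k : ℕ}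
    (hk : k + 2 ≤ N) (b : ℕ → Bool) :
    socialOffload T N f (swapX X k) b
      = socialOffload T N f X (b ∘ Equiv.swap k (k + 1)) := by
  unfold socialOffload
  refine sum_congr rfl fun t _ => congrArg (f t) ?_
  refine sum_equiv (Equiv.swap k (k + 1)) (fun n => ?_) (fun n _ => ?_)
  · simp only [mem_range, Equiv.swap_apply_def]
    split_ifs <;> omega
  · simp [swapX_eq_comp_swap]

lemma Waux_swap (T N : ℕ) (f : ℕ → ℝ → ℝ) (X : ℕ → ℕ → ℝ) (Q : ℕ → ℝ) {k : ℕ}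
    (j : ℕ) (hj : j + (k + 2) ≤ N) (b : ℕ → Bool) :
    Waux T N f (swapX X k) (swapQ Q k) j b
      = Waux T N f X Q j (b ∘ Equiv.swap k (k + 1)) := by
  induction j generalizing b with
  | zero => exact socialOffload_swapX T N f X (by omega) b
  | succ j ih =>
    have h₁ : N - (j + 1) ≠ k := by omega
    have h₂ : N - (j + 1) ≠ k + 1 := by omega
    simp only [Waux, ih (by omega), update_comp_swap_of_ne _ _ h₁ h₂, swapQ_of_ne h₁ h₂]

lemma monotone_socialOffload {T N : ℕ} {f : ℕ → ℝ → ℝ} {X : ℕ → ℕ → ℝ}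
    (hf : ∀ t, t < T → MonotoneOn (f t) (Set.Ici (0 : ℝ)))
    (hX : ∀ n, n < N → ∀ t, t < T → 0 ≤ X n t) :
    Monotone (socialOffload T N f X) := by
  intro b c hbc
  refine sum_le_sum fun t ht => ?_
  have ht := mem_range.1 ht
  have nonneg (d : ℕ → Bool) : 0 ≤ ∑ n ∈ range N, if d n then X n t else 0 :=
    sum_nonneg fun n hn => by
      split_ifs
      exacts [hX n (mem_range.1 hn) t ht, le_rfl]
  refine hf t ht (nonneg b) (nonneg c) (sum_le_sum fun n hn => ?_)
  have hn := hX n (mem_range.1 hn) t ht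
  have hle : b n = true → c n = true := hbc n
  cases hb : b n <;> cases hc : c n <;> simp_all

lemma monotone_Waux {T N : ℕ} {f : ℕ → ℝ → ℝ} {X : ℕ → ℕ → ℝ} (Q : ℕ → ℝ)
    (hf : ∀ t, t < T → MonotoneOn (f t) (Set.Ici (0 : ℝ)))
    (hX : ∀ n, n < N → ∀ t, t < T → 0 ≤ X n t) (j : ℕ) :
    Monotone (Waux T N f X Q j) := by
  induction j with
  | zero => exact monotone_socialOffload hf hX
  | succ j ih =>
    intro b c hbc
    have key (v : Bool) := ih (update_le_update_iff.2
      ⟨le_refl v, fun i (_ : i ≠ N - (j + 1)) => hbc i⟩)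
    simp only [Waux]
    gcongr <;> exact key _

/-- The two-stage comparison: `vxy` is the continuation value when the operator with
parameter `p` has outcome `x` and the one with parameter `q` has outcome `y`. -/
lemma two_step_le {v00 v01 v10 v11 p q : ℝ} (hq : 0 ≤ q) (h0 : v00 ≤ v01) (h1 : v10 ≤ v11) :
    1 / 2 * (1 / 2 * v00 + 1 / 2 * max v00 (v01 + q))
      + 1 / 2 * max (1 / 2 * v00 + 1 / 2 * max v00 (v01 + q))
          (1 / 2 * v10 + 1 / 2 * max v10 (v11 + q) + p)
    ≤ 1 / 2 * (1 / 2 * v00 + 1 / 2 * max v00 (v10 + p))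
      + 1 / 2 * max (1 / 2 * v00 + 1 / 2 * max v00 (v10 + p))
          (1 / 2 * v01 + 1 / 2 * max v01 (v11 + p) + q) := by
  rw [max_eq_right (by linarith : v00 ≤ v01 + q), max_eq_right (by linarith : v10 ≤ v11 + q)]
  have a := le_max_left v00 (v10 + p)
  have b := le_max_right v00 (v10 + p)
  have c := le_max_left v01 (v11 + p)
  have d := le_max_right v01 (v11 + p)
  have e := le_max_right (1 / 2 * v00 + 1 / 2 * max v00 (v10 + p))
    (1 / 2 * v01 + 1 / 2 * max v01 (v11 + p) + q)
  rcases max_cases (1 / 2 * v00 + 1 / 2 * (v01 + q))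
    (1 / 2 * v10 + 1 / 2 * (v11 + q) + p) with ⟨h, _⟩ | ⟨h, _⟩ <;> rw [h] <;> linarith

lemma update_update_comp_swap (b : ℕ → Bool) (k : ℕ) (x y : Bool) :
    Function.update (Function.update b k x) (k + 1) y ∘ Equiv.swap k (k + 1)
      = Function.update (Function.update b k y) (k + 1) x := by
  funext n
  simp only [Function.comp_apply, Equiv.swap_apply_def, Function.update_apply]
  split_ifs <;> first | rfl | omega

lemma Waux_le_swap {T N : ℕ} {f : ℕ → ℝ → ℝ} {X : ℕ → ℕ → ℝ} {Q : ℕ → ℝ}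
    (hf : ∀ t, t < T → MonotoneOn (f t) (Set.Ici (0 : ℝ)))
    (hX : ∀ n, n < N → ∀ t, t < T → 0 ≤ X n t)
    {k j : ℕ} (hj : j + (k + 2) = N) (hQ : 0 ≤ Q (k + 1)) (b : ℕ → Bool) :
    Waux T N f X Q (j + 2) b ≤ Waux T N f (swapX X k) (swapQ Q k) (j + 2) b := by
  have h₁ : N - (j + 1) = k + 1 := by omega
  have h₂ : N - (j + 1 + 1) = k := by omega
  have mono (x : Bool) :
      Waux T N f X Q j (Function.update (Function.update b k x) (k + 1) false) ≤
        Waux T N f X Q j (Function.update (Function.update b k x) (k + 1) true) :=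
    monotone_Waux Q hf hX j (update_le_update_iff.2
      ⟨Bool.false_le _, fun _ _ => le_rfl⟩)
  have hp : swapQ Q k (k + 1) = Q k := by simp [swapQ]
  have hq : swapQ Q k k = Q (k + 1) := by simp [swapQ]
  simp only [Waux, h₁, h₂, Waux_swap T N f X Q j hj.le, update_update_comp_swap, hp, hq]
  exact two_step_le hQ (mono false) (mono true)

lemma Waux_le_swap_add {T N : ℕ} {f : ℕ → ℝ → ℝ} {X : ℕ → ℕ → ℝ} {Q : ℕ → ℝ}
    (hf : ∀ t, t < T → MonotoneOn (f t) (Set.Ici (0 : ℝ)))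
    (hX : ∀ n, n < N → ∀ t, t < T → 0 ≤ X n t)
    {k j : ℕ} (hj : j + (k + 2) = N) (hQ : 0 ≤ Q (k + 1)) (i : ℕ) (hi : i ≤ k)
    (b : ℕ → Bool) :
    Waux T N f X Q (j + 2 + i) b ≤ Waux T N f (swapX X k) (swapQ Q k) (j + 2 + i) b := by
  induction i generalizing b with
  | zero => exact Waux_le_swap hf hX hj hQ b
  | succ i ih =>
    have key := ih (by omega)
    have hne : N - (j + 2 + i + 1) ≠ k ∧ N - (j + 2 + i + 1) ≠ k + 1 := by omega
    rw [← add_assoc, Waux, Waux, swapQ_of_ne hne.1 hne.2]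
    gcongr <;> exact key _

/-- Proposition 3: if the VO at (paper) position `k+2` is of type 1
(`Q_{k+2} ≥ 0`), exchanging bargaining positions `k+1` and `k+2` does not decrease
the MNO's payoff `U_0 = W_0`. -/
theorem swap_type1_payoff_le (T N : ℕ) (hT : 1 ≤ T) (hN : 2 ≤ N)
    (f : ℕ → ℝ → ℝ) (X : ℕ → ℕ → ℝ) (Q : ℕ → ℝ)
    (hf : ∀ t, t < T → MonotoneOn (f t) (Set.Ici (0 : ℝ)) ∧
      ConcaveOn ℝ (Set.Ici (0 : ℝ)) (f t) ∧ f t 0 = 0)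
    (hX : ∀ n, n < N → ∀ t, t < T → 0 ≤ X n t)
    (k : ℕ) (hk : k + 2 ≤ N) (hQ : 0 ≤ Q (k + 1)) :
    W T N f X Q 0 (fun _ => false) ≤
      W T N f (swapX X k) (swapQ Q k) 0 (fun _ => false) := by
  obtain ⟨j, rfl⟩ : ∃ j, N = j + (k + 2) := ⟨N - (k + 2), by omega⟩
  have h : j + (k + 2) - 0 = j + 2 + k := by omega
  simp only [W, h]
  exact Waux_le_swap_add (fun t ht => (hf t ht).1) hX rfl hQ k le_rfl _
end

section
/- Fix any enumeration h¹_1,…,h¹_{N_1} of the type-1 VOs and any enumeration h³_1,…,h³_{N_3} of the type-3 VOs, and let L^RE be the set of permutations σ of {1,…,N} with σ(i) = h¹_i for i ∈ {1,…,N_1} and σ(N_1+N_2+j) = h³_j for j ∈ {1,…,N_3} (so the middle N_2 positions hold the type-2 VOs in some order). Then max_{σ ∈ L^RE} U_0^σ = max_σ U_0^σ, where the second maximum is over all permutations of {1,…,N}; that is, the sequence returned by the OVBS algorithm is an optimal bargaining sequence. -/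
open Finset

/-- Parameters reindexed by a bargaining sequence `σ`: at (0-based) step `k < N`
the MNO bargains with VO `σ k`. -/
noncomputable def permQ (N : ℕ) (Q : ℕ → ℝ) (σ : Equiv.Perm (Fin N)) : ℕ → ℝ :=
  fun k => if h : k < N then Q ((σ ⟨k, h⟩ : Fin N) : ℕ) else Q k

noncomputable def permX (N : ℕ) (X : ℕ → ℕ → ℝ) (σ : Equiv.Perm (Fin N)) :
    ℕ → ℕ → ℝ :=
  fun n t => if h : n < N then X ((σ ⟨n, h⟩ : Fin N) : ℕ) t else X n t

/-- `U_0^σ = W_0^σ`: the MNO's payoff under the bargaining sequence `σ`. -/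
noncomputable def U0perm (T N : ℕ) (f : ℕ → ℝ → ℝ) (X : ℕ → ℕ → ℝ) (Q : ℕ → ℝ)
    (σ : Equiv.Perm (Fin N)) : ℝ :=
  W T N f (permX N X σ) (permQ N Q σ) 0 (fun _ => false)

/-- `N₁`: the number of type-1 VOs (those with `Q_n ≥ 0`). -/
noncomputable def numType1 (N : ℕ) (Q : ℕ → ℝ) : ℕ :=
  ((range N).filter fun n => 0 ≤ Q n).card

/-- `N₂`: the number of type-2 VOs (`Q_n < 0` and `Σ_t f_t(X_n^t) + Q_n ≥ 0`). -/
noncomputable def numType2 (T N : ℕ) (f : ℕ → ℝ → ℝ) (X : ℕ → ℕ → ℝ)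
    (Q : ℕ → ℝ) : ℕ :=
  ((range N).filter fun n =>
    Q n < 0 ∧ 0 ≤ (∑ t ∈ range T, f t (X n t)) + Q n).card

/-- `N₃`: the number of type-3 VOs (`Σ_t f_t(X_n^t) + Q_n < 0`). -/
noncomputable def numType3 (T N : ℕ) (f : ℕ → ℝ → ℝ) (X : ℕ → ℕ → ℝ)
    (Q : ℕ → ℝ) : ℕ :=
  ((range N).filter fun n => (∑ t ∈ range T, f t (X n t)) + Q n < 0).card

/-- One bargaining step with agent `a`: the MNO's value `½·V(S) + ½·max{V(S), V(S ∪ {a}) + Q_a}`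
when `S` is the multiset of agents that have cooperated so far. -/
noncomputable def bargainStep {ι : Type*} (Q : ι → ℝ) (a : ι) (V : Multiset ι → ℝ)
    (S : Multiset ι) : ℝ :=
  (1 / 2) * V S + (1 / 2) * max (V S) (V (a ::ₘ S) + Q a)

/-- The MNO's value when it still has to bargain with the agents of a list, in that order, and
`F` is the terminal value. -/
noncomputable def seqValue {ι : Type*} (Q : ι → ℝ) (F : Multiset ι → ℝ) :
    List ι → Multiset ι → ℝ
  | [] => F
  | a :: l => bargainStep Q a (seqValue Q F l)

section SeqValue

variable {ι : Type*} {Q : ι → ℝ} {F V V' : Multiset ι → ℝ} {a b : ι}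

theorem bargainStep_mono (h : ∀ S, V S ≤ V' S) (S : Multiset ι) :
    bargainStep Q a V S ≤ bargainStep Q a V' S := by
  unfold bargainStep
  gcongr <;> apply h

theorem bargainStep_le_cons_add {c : ℝ} (h : ∀ S, V (b ::ₘ S) ≤ V S + c) (S : Multiset ι) :
    bargainStep Q a V (b ::ₘ S) ≤ bargainStep Q a V S + c := by
  unfold bargainStep
  rw [Multiset.cons_swap]
  have h₁ := h S
  have h₂ := h (a ::ₘ S)
  grind

theorem le_bargainStep_cons (h : ∀ S, V S ≤ V (b ::ₘ S)) (S : Multiset ι) :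
    bargainStep Q a V S ≤ bargainStep Q a V (b ::ₘ S) := by
  unfold bargainStep
  rw [Multiset.cons_swap]
  gcongr <;> apply h

theorem seqValue_le_cons_add {c : ℝ} (h : ∀ S, F (b ::ₘ S) ≤ F S + c) (l : List ι) :
    ∀ S, seqValue Q F l (b ::ₘ S) ≤ seqValue Q F l S + c := by
  induction l with
  | nil => exact h
  | cons a l ih => exact bargainStep_le_cons_add ih

theorem le_seqValue_cons (h : ∀ S, F S ≤ F (b ::ₘ S)) (l : List ι) :
    ∀ S, seqValue Q F l S ≤ seqValue Q F l (b ::ₘ S) := by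
  induction l with
  | nil => exact h
  | cons a l ih => exact le_bargainStep_cons ih

/-- With an agent whose cooperation always helps, the step is a plain average. -/
theorem bargainStep_of_nonneg (hQ : 0 ≤ Q a) (h : ∀ S, V S ≤ V (a ::ₘ S)) (S : Multiset ι) :
    bargainStep Q a V S = (1 / 2) * V S + (1 / 2) * (V (a ::ₘ S) + Q a) := by
  unfold bargainStep
  rw [max_eq_right (by linarith [h S])]

/-- An agent whose cooperation never helps has no effect. -/
theorem bargainStep_of_neg {c : ℝ} (hc : c + Q a < 0) (h : ∀ S, V (a ::ₘ S) ≤ V S + c) :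
    bargainStep Q a V = V := by
  funext S
  unfold bargainStep
  rw [max_eq_left (by linarith [h S])]
  ring

/-- Bargaining earlier with an agent whose cooperation always helps is at least as good. -/
theorem bargainStep_bargainStep_le (hQ : 0 ≤ Q b) (h : ∀ S, V S ≤ V (b ::ₘ S))
    (S : Multiset ι) :
    bargainStep Q a (bargainStep Q b V) S ≤ bargainStep Q b (bargainStep Q a V) S := by
  rw [bargainStep_of_nonneg hQ (le_bargainStep_cons h)]
  unfold bargainStep
  rw [Multiset.cons_swap a b S]
  have h₁ := h S
  have h₂ := h (a ::ₘ S)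
  clear h
  grind

theorem bargainStep_comm (ha : 0 ≤ Q a) (hb : 0 ≤ Q b) (hVa : ∀ S, V S ≤ V (a ::ₘ S))
    (hVb : ∀ S, V S ≤ V (b ::ₘ S)) :
    bargainStep Q a (bargainStep Q b V) = bargainStep Q b (bargainStep Q a V) :=
  funext fun S =>
    (bargainStep_bargainStep_le hb hVb S).antisymm (bargainStep_bargainStep_le ha hVa S)

theorem seqValue_append (l m : List ι) :
    seqValue Q F (l ++ m) = seqValue Q (seqValue Q F m) l := by
  induction l with
  | nil => rfl
  | cons a l ih => simp only [List.cons_append, seqValue, ih]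

theorem seqValue_perm (hF : ∀ b S, F S ≤ F (b ::ₘ S)) {l m : List ι} (hlm : l.Perm m)
    (hl : ∀ a ∈ l, 0 ≤ Q a) : seqValue Q F l = seqValue Q F m := by
  induction hlm with
  | nil => rfl
  | cons a _ ih => simp only [seqValue, ih fun b hb => hl b (List.mem_cons_of_mem _ hb)]
  | swap a b l =>
    exact bargainStep_comm (hl b (by simp)) (hl a (by simp)) (le_seqValue_cons (hF b) l)
      (le_seqValue_cons (hF a) l)
  | trans h₁ _ ih₁ ih₂ =>
    rw [ih₁ hl, ih₂ fun a ha => hl a (h₁.mem_iff.2 ha)]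

theorem bargainStep_seqValue_le (hF : ∀ b S, F S ≤ F (b ::ₘ S)) {l : List ι}
    (hl : ∀ a ∈ l, 0 ≤ Q a) :
    ∀ S, bargainStep Q a (seqValue Q F l) S ≤ seqValue Q (bargainStep Q a F) l S := by
  induction l with
  | nil => exact fun S => le_rfl
  | cons b l ih =>
    intro S
    refine (bargainStep_bargainStep_le (hl b (by simp)) (le_seqValue_cons (hF b) l) S).trans ?_
    exact bargainStep_mono (ih fun c hc => hl c (List.mem_cons_of_mem _ hc)) S

theorem seqValue_of_neg {c : ι → ℝ} (hc : ∀ a S, F (a ::ₘ S) ≤ F S + c a) {l : List ι}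
    (hl : ∀ a ∈ l, c a + Q a < 0) : seqValue Q F l = F := by
  induction l with
  | nil => rfl
  | cons a l ih =>
    simp only [seqValue, ih fun b hb => hl b (List.mem_cons_of_mem _ hb)]
    exact bargainStep_of_neg (hl a (by simp)) (hc a)

/-- Moving the agents with `0 ≤ Q a` to the front and dropping those with `c a + Q a < 0` does
not decrease the value. -/
theorem seqValue_le_filter_append {c : ι → ℝ} (hF : ∀ b S, F S ≤ F (b ::ₘ S))
    (hc : ∀ a S, F (a ::ₘ S) ≤ F S + c a) (l : List ι) :
    ∀ S, seqValue Q F l S ≤ seqValue Q F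
      (l.filter (fun a => 0 ≤ Q a) ++ l.filter (fun a => Q a < 0 ∧ 0 ≤ c a + Q a)) S := by
  induction l with
  | nil => exact fun S => le_rfl
  | cons a l ih =>
    intro S
    refine (bargainStep_mono ih S).trans ?_
    by_cases h₁ : 0 ≤ Q a
    · simp [h₁, h₁.not_gt, seqValue]
    by_cases h₂ : 0 ≤ c a + Q a
    · have h₁' : Q a < 0 := not_le.1 h₁
      simp only [h₁, h₁', h₂, seqValue_append, List.filter_cons, decide_false, decide_true,
        and_self, if_true, Bool.false_eq_true, if_false, seqValue]
      exact bargainStep_seqValue_le (fun b => le_seqValue_cons (hF b) _)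
        (fun b hb => by simpa using (List.mem_filter.1 hb).2) S
    · rw [bargainStep_of_neg (not_le.1 h₂) (seqValue_le_cons_add (hc a) _)]
      simp [h₁, h₂]

end SeqValue

theorem ConcaveOn.map_add_le_of_map_zero {g : ℝ → ℝ} (hg : ConcaveOn ℝ (Set.Ici 0) g)
    (h0 : g 0 = 0) {x y : ℝ} (hx : 0 ≤ x) (hy : 0 ≤ y) : g (x + y) ≤ g x + g y := by
  rcases (add_nonneg hx hy).eq_or_lt with h | h
  · obtain rfl : x = 0 := by linarith
    simp [h0]
  have key : ∀ u v : ℝ, 0 ≤ u → 0 ≤ v → 0 < u + v → u / (u + v) * g (u + v) ≤ g u := by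
    intro u v hu hv huv
    have := hg.2 (Set.mem_Ici.2 huv.le) (Set.mem_Ici.2 le_rfl) (div_nonneg hu huv.le)
      (div_nonneg hv huv.le) (by field_simp)
    simpa [h0, div_mul_cancel₀ u huv.ne'] using this
  have hxy := key x y hx hy h
  have hyx := key y x hy hx (by linarith)
  rw [add_comm y x] at hyx
  calc g (x + y) = x / (x + y) * g (x + y) + y / (x + y) * g (x + y) := by field_simp
    _ ≤ g x + g y := add_le_add hxy hyx

/-- The offloading benefit of a multiset of cooperating VOs. -/
noncomputable def multisetOffload (T N : ℕ) (f : ℕ → ℝ → ℝ) (X : ℕ → ℕ → ℝ)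
    (S : Multiset (Fin N)) : ℝ :=
  ∑ t ∈ range T, f t ((S.map fun n : Fin N => X n t).sum)

section Offload

variable {T N : ℕ} {f : ℕ → ℝ → ℝ} {X : ℕ → ℕ → ℝ}

theorem sum_map_offload_nonneg (hX : ∀ n, n < N → ∀ t, t < T → 0 ≤ X n t)
    (S : Multiset (Fin N)) {t : ℕ} (ht : t < T) : 0 ≤ (S.map fun n : Fin N => X n t).sum := by
  refine Multiset.sum_nonneg fun x hx => ?_
  obtain ⟨n, -, rfl⟩ := Multiset.mem_map.1 hx
  exact hX n n.2 t ht

theorem multisetOffload_le_cons (hf : ∀ t, t < T → MonotoneOn (f t) (Set.Ici (0 : ℝ)))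
    (hX : ∀ n, n < N → ∀ t, t < T → 0 ≤ X n t) (a : Fin N) (S : Multiset (Fin N)) :
    multisetOffload T N f X S ≤ multisetOffload T N f X (a ::ₘ S) := by
  refine sum_le_sum fun t ht => ?_
  have ht' := mem_range.1 ht
  have hS := sum_map_offload_nonneg hX S ht'
  have ha := hX a a.2 t ht'
  rw [Multiset.map_cons, Multiset.sum_cons]
  exact hf t ht' hS (Set.mem_Ici.2 (by linarith)) (by linarith)

theorem multisetOffload_cons_le
    (hf : ∀ t, t < T → ConcaveOn ℝ (Set.Ici (0 : ℝ)) (f t) ∧ f t 0 = 0)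
    (hX : ∀ n, n < N → ∀ t, t < T → 0 ≤ X n t) (a : Fin N) (S : Multiset (Fin N)) :
    multisetOffload T N f X (a ::ₘ S) ≤
      multisetOffload T N f X S + ∑ t ∈ range T, f t (X a t) := by
  unfold multisetOffload
  rw [← sum_add_distrib]
  refine sum_le_sum fun t ht => ?_
  have ht' := mem_range.1 ht
  rw [Multiset.map_cons, Multiset.sum_cons, add_comm]
  exact (hf t ht').1.map_add_le_of_map_zero (hf t ht').2 (sum_map_offload_nonneg hX S ht')
    (hX a a.2 t ht')

theorem Waux_perm_eq_seqValue (Q : ℕ → ℝ) (σ : Equiv.Perm (Fin N)) :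
    ∀ j, j ≤ N → ∀ (b : ℕ → Bool) (S : Multiset (Fin N)),
      (∀ n, N - j ≤ n → b n = false) →
      (∀ t, (∑ n ∈ range N, if b n then permX N X σ n t else 0) =
        (S.map fun n : Fin N => X n t).sum) →
      Waux T N f (permX N X σ) (permQ N Q σ) j b =
        seqValue (fun n : Fin N => Q n) (multisetOffload T N f X)
          ((List.ofFn σ).drop (N - j)) S := by
  intro j
  induction j with
  | zero =>
    intro _ b S _ hS
    rw [Nat.sub_zero, List.drop_eq_nil_of_le (by simp)]
    simp only [Waux, socialOffload, seqValue, multisetOffload, hS]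
  | succ j ih =>
    intro hj b S hb hS
    have hk : N - (j + 1) < N := by omega
    have hk' : N - (j + 1) + 1 = N - j := by omega
    have hfalse : Function.update b (N - (j + 1)) false = b := by
      rw [← hb _ le_rfl, Function.update_eq_self]
    have hQ : permQ N Q σ (N - (j + 1)) = Q (σ ⟨N - (j + 1), hk⟩) := by simp [permQ, hk]
    rw [List.drop_eq_getElem_cons (by simpa using hk), hk', List.getElem_ofFn]
    simp only [Waux, seqValue, bargainStep, hfalse, hQ]
    rw [ih (by omega) b S (fun n hn => hb n (by omega)) hS,
      ih (by omega) (Function.update b (N - (j + 1)) true) (σ ⟨N - (j + 1), hk⟩ ::ₘ S)]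
    · intro n hn
      rw [Function.update_of_ne (by omega)]
      exact hb n (by omega)
    · intro t
      rw [Multiset.map_cons, Multiset.sum_cons, ← hS,
        ← add_sum_erase _ _ (mem_range.2 hk),
        ← add_sum_erase (range N) (fun n => if b n then permX N X σ n t else 0)
          (mem_range.2 hk)]
      simp only [Function.update_self, hb _ le_rfl, if_true, Bool.false_eq_true, if_false,
        zero_add]
      congr 1
      · simp [permX, hk]
      · refine sum_congr rfl fun n hn => ?_
        rw [Function.update_of_ne (ne_of_mem_erase hn)]

theorem U0perm_eq_seqValue (Q : ℕ → ℝ) (σ : Equiv.Perm (Fin N)) :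
    U0perm T N f X Q σ =
      seqValue (fun n : Fin N => Q n) (multisetOffload T N f X) (List.ofFn σ) 0 := by
  have := Waux_perm_eq_seqValue (T := T) (f := f) (X := X) Q σ N le_rfl (fun _ => false) 0
    (fun _ _ => rfl) (by simp)
  simpa [U0perm, W] using this

end Offload

theorem length_filter_ofFn_perm {N : ℕ} (σ : Equiv.Perm (Fin N)) (p : ℕ → Prop)
    [DecidablePred p] :
    ((List.ofFn σ).filter fun n : Fin N => p n).length = ((range N).filter p).card := by
  have h : (List.ofFn σ).Perm (List.finRange N) :=
    (List.perm_ext_iff_of_nodup (List.nodup_ofFn.2 σ.injective) (List.nodup_finRange N)).2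
      fun a => by simpa [List.mem_ofFn] using σ.surjective a
  rw [(h.filter _).length_eq, ← List.toFinset_card_of_nodup ((List.nodup_finRange N).filter _),
    ← card_map Fin.valEmbedding]
  congr 1
  ext n
  simp only [mem_map, List.mem_toFinset, List.mem_filter, List.mem_finRange, mem_filter,
    mem_range, Fin.valEmbedding_apply, decide_eq_true_eq, true_and]
  exact ⟨fun ⟨a, ha, h⟩ => h ▸ ⟨a.2, ha⟩, fun ⟨hn, h⟩ => ⟨⟨n, hn⟩, h, rfl⟩⟩

/-- An injective enumeration of the right length of the VOs with property `p` lists exactly the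
VOs with property `p`. -/
theorem enumeration_perm_filter {N : ℕ} (σ : Equiv.Perm (Fin N)) (p : ℕ → Prop)
    [DecidablePred p] (h : ℕ → Fin N) {m : ℕ} (hm : ((range N).filter p).card = m)
    (hp : ∀ i, i < m → p (h i)) (hinj : ∀ i j, i < m → j < m → h i = h j → i = j) :
    ((List.range m).map h).Perm ((List.ofFn σ).filter fun n : Fin N => p n) := by
  have hnodup : ((List.range m).map h).Nodup :=
    List.nodup_range.map_on fun i hi j hj =>
      hinj i j (List.mem_range.1 hi) (List.mem_range.1 hj)
  refine (hnodup.subperm fun a ha => ?_).perm_of_length_le ?_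
  · obtain ⟨i, hi, rfl⟩ := List.mem_map.1 ha
    exact List.mem_filter.2 ⟨List.mem_ofFn.2 (σ.surjective _),
      by simpa using hp i (List.mem_range.1 hi)⟩
  · rw [length_filter_ofFn_perm, hm]
    simp

theorem exists_perm_ofFn_eq {N : ℕ} {l : List (Fin N)} (hl : l.Nodup) (hlen : l.length = N) :
    ∃ σ : Equiv.Perm (Fin N), List.ofFn σ = l := by
  have hinj : Function.Injective fun i : Fin N => l.get (i.cast hlen.symm) :=
    (List.nodup_iff_injective_get.1 hl).comp (Fin.cast_injective _)
  refine ⟨Equiv.ofBijective _ (Finite.injective_iff_bijective.1 hinj), ?_⟩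
  refine List.ext_getElem (by simp [hlen]) fun i _ _ => by simp

theorem filter_append_perm_of_trichotomy {ι : Type*} {p q r : ι → Bool}
    (h : ∀ a, (p a && !q a && !r a) || (!p a && q a && !r a) || (!p a && !q a && r a))
    (l : List ι) : (l.filter p ++ l.filter q ++ l.filter r).Perm l := by
  classical
  rw [List.perm_iff_count]
  intro a
  have hcount (s : ι → Bool) : (l.filter s).count a = if s a then l.count a else 0 := by
    split_ifs with hs
    · exact List.count_filter hs
    · exact List.count_eq_zero.2 fun hmem => hs (List.mem_filter.1 hmem).2
  have := h a
  simp only [List.count_append, hcount]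
  grind

/-- Theorem 2, optimality of OVBS: fix an enumeration `h1` of the
type-1 VOs and an enumeration `h3` of the type-3 VOs; among the bargaining
sequences of the reduced set `L^RE` (those keeping `h1` in the first `N₁`
positions and `h3` in the last `N₃` positions, the type-2 VOs being permuted in
the middle) there is one attaining the maximum of `U_0^σ` over all sequences. -/
theorem OVBS_optimal (T N : ℕ) (hT : 1 ≤ T) (hN : 1 ≤ N)
    (f : ℕ → ℝ → ℝ) (X : ℕ → ℕ → ℝ) (Q : ℕ → ℝ)
    (hf : ∀ t, t < T → MonotoneOn (f t) (Set.Ici (0 : ℝ)) ∧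
      ConcaveOn ℝ (Set.Ici (0 : ℝ)) (f t) ∧ f t 0 = 0)
    (hX : ∀ n, n < N → ∀ t, t < T → 0 ≤ X n t)
    (h1 : ℕ → Fin N) (h3 : ℕ → Fin N)
    (h1type : ∀ i, i < numType1 N Q → 0 ≤ Q ((h1 i : Fin N) : ℕ))
    (h1inj : ∀ i j, i < numType1 N Q → j < numType1 N Q → h1 i = h1 j → i = j)
    (h3type : ∀ i, i < numType3 T N f X Q →
      (∑ t ∈ range T, f t (X ((h3 i : Fin N) : ℕ) t)) + Q ((h3 i : Fin N) : ℕ) < 0)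
    (h3inj : ∀ i j, i < numType3 T N f X Q → j < numType3 T N f X Q →
      h3 i = h3 j → i = j) :
    ∃ σ : Equiv.Perm (Fin N),
      (∀ i : Fin N, (i : ℕ) < numType1 N Q → σ i = h1 (i : ℕ)) ∧
      (∀ i : Fin N, ∀ j, j < numType3 T N f X Q →
        (i : ℕ) = numType1 N Q + numType2 T N f X Q + j → σ i = h3 j) ∧
      (∀ τ : Equiv.Perm (Fin N), U0perm T N f X Q τ ≤ U0perm T N f X Q σ) := by
  have hF : ∀ b S, multisetOffload T N f X S ≤ multisetOffload T N f X (b ::ₘ S) :=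
    multisetOffload_le_cons (fun t ht => (hf t ht).1) hX
  have hc := multisetOffload_cons_le (fun t ht => (hf t ht).2) hX
  obtain ⟨τ, hτ⟩ := Finite.exists_max (U0perm T N f X Q)
  set c : ℕ → ℝ := fun n => ∑ t ∈ range T, f t (X n t) 
  have hc0 : ∀ n : Fin N, 0 ≤ c n := fun n => sum_nonneg fun t ht => by
    have ht' := mem_range.1 ht
    have := (hf t ht').1 (Set.mem_Ici.2 le_rfl) (hX n n.2 t ht') (hX n n.2 t ht')
    rwa [(hf t ht').2.2] at this
  have hperm₁ := enumeration_perm_filter τ (fun n => 0 ≤ Q n) h1 (m := numType1 N Q) rfl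
    h1type h1inj
  have hperm₃ := enumeration_perm_filter τ (fun n => c n + Q n < 0) h3
    (m := numType3 T N f X Q) rfl h3type h3inj
  have hlen₂ := length_filter_ofFn_perm τ (fun n => Q n < 0 ∧ 0 ≤ c n + Q n)
  change _ = numType2 T N f X Q at hlen₂
  set l₁ := (List.range (numType1 N Q)).map h1
  set l₂ := (List.ofFn τ).filter fun n : Fin N => Q n < 0 ∧ 0 ≤ c n + Q n
  set l₃ := (List.range (numType3 T N f X Q)).map h3
  have hperm : (l₁ ++ l₂ ++ l₃).Perm (List.ofFn τ) := by
    refine ((hperm₁.append_right l₂).append hperm₃).trans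
      (filter_append_perm_of_trichotomy (fun n => ?_) _)
    have hn := hc0 n
    rcases le_or_gt 0 (Q n) with h | h
    · have h' : ¬c n + Q n < 0 := by linarith
      simp [h, h.not_gt, h']
    · rcases le_or_gt 0 (c n + Q n) with h' | h'
      · simp [h, h.not_ge, h', h'.not_gt]
      · simp [h.not_ge, h', h'.not_ge]
  obtain ⟨σ, hσ⟩ := exists_perm_ofFn_eq
    (hperm.nodup_iff.2 (List.nodup_ofFn.2 τ.injective)) (by simpa using hperm.length_eq)
  have hget : ∀ i : Fin N, (l₁ ++ l₂ ++ l₃)[(i : ℕ)]? = some (σ i) := fun i => by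
    rw [← hσ]
    simp
  have hlen₁ : l₁.length = numType1 N Q := by simp [l₁]
  refine ⟨σ, fun i hi => ?_, fun i j hj hij => ?_, fun ρ => (hτ ρ).trans ?_⟩
  · have := hget i
    rw [List.append_assoc, List.getElem?_append_left (by omega)] at this
    simpa [l₁, hi] using this.symm
  · have := hget i
    rw [List.getElem?_append_right (by simp only [List.length_append]; omega),
      List.length_append, hlen₁, hlen₂, hij, Nat.add_sub_cancel_left] at this
    simpa [l₃, hj] using this.symm
  · rw [U0perm_eq_seqValue, U0perm_eq_seqValue, hσ, seqValue_append,
      seqValue_of_neg (c := fun n : Fin N => c n) (l := l₃) hc fun n hn =>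
        by simpa using (List.mem_filter.1 (hperm₃.mem_iff.1 hn)).2]
    refine (seqValue_le_filter_append hF hc _ 0).trans_eq ?_
    rw [seqValue_append, seqValue_append,
      seqValue_perm (fun b => le_seqValue_cons (hF b) _) hperm₁.symm fun n hn =>
        by simpa using (List.mem_filter.1 hn).2]
end
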